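/- Let g and Δx be positive real numbers, P a natural number, and let η_p, z⁺_p, z⁻_p (p = 0, …, P) be real numbers (free-surface and interface-topography expansion coefficients). Define the reconstructed water-depth coefficients a_p = η_p − z⁺_p and b_p = η_p − z⁻_p. Then for every natural number l, the ensemble-averaged momentum flux gradient balances the ensemble-averaged bed slope source term: (g/(2Δx))·Σ_{p=0}^P Σ_{s=0}^P (a_p·a_s − b_p·b_s)·⟨Φ_p Φ_s Φ_l⟩ = −(g/Δx)·Σ_{p=0}^P Σ_{s=0}^P ((b_p + a_p)/2)·(z⁺_s − z⁻_s)·⟨Φ_p Φ_s Φ_l⟩, where ⟨Φ_p Φ_s Φ_l⟩ = ∫_ℝ Φ_p(ξ) Φ_s(ξ) Φ_l(ξ) dγ(ξ). -/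

import Mathlib

open MeasureTheory ProbabilityTheory Polynomial

/-- The probabilists' Hermite polynomial of degree `p`, evaluated at `ξ`. -/
noncomputable def Φ (p : ℕ) (ξ : ℝ) : ℝ := aeval ξ (hermite p)

/-- The standard Gaussian measure on ℝ (mean 0, variance 1). -/
noncomputable def γ : Measure ℝ := gaussianReal 0 1

/-- Difference of squares for a symmetric bilinear form given by its coefficients. -/
theorem sum_mul_sub_mul_eq_sum_add_mul_sub {ι R : Type*} [CommRing R] (S : Finset ι)
    (a b : ι → R) (T : ι → ι → R) (hT : ∀ p s, T p s = T s p) :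
    ∑ p ∈ S, ∑ s ∈ S, (a p * a s - b p * b s) * T p s
      = ∑ p ∈ S, ∑ s ∈ S, (b p + a p) * (a s - b s) * T p s := by
  have hswap : ∑ p ∈ S, ∑ s ∈ S, a p * b s * T p s = ∑ p ∈ S, ∑ s ∈ S, b p * a s * T p s := by
    rw [Finset.sum_comm]
    refine Finset.sum_congr rfl fun p _ => Finset.sum_congr rfl fun s _ => ?_
    rw [hT s p, mul_comm (a s)]
  have hexpand : ∀ p s, (b p + a p) * (a s - b s) * T p s
      = (a p * a s - b p * b s) * T p s + (b p * a s * T p s - a p * b s * T p s) :=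
    fun p s => by ring
  simp only [hexpand, Finset.sum_add_distrib, Finset.sum_sub_distrib, hswap, sub_self, add_zero]

/-- Discrete well-balanced property of the stochastic Galerkin surface gradient
method with uncertain topography: for a lake-at-rest with free-surface
coefficients `η_p` and reconstructed depth coefficients `a_p = η_p − z⁺_p`,
`b_p = η_p − z⁻_p`, the ensemble-averaged momentum flux gradient balances the
ensemble-averaged bed slope source term, for every basis function `Φ_l`. -/
theorem discrete_well_balanced (g Δx : ℝ) (hg : 0 < g) (hΔx : 0 < Δx) (P : ℕ)
    (η zp zm : ℕ → ℝ) (l : ℕ) :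
    (fun a b =>
      g / (2 * Δx) *
          ∑ p ∈ Finset.range (P + 1), ∑ s ∈ Finset.range (P + 1),
            (a p * a s - b p * b s) * (∫ ξ, Φ p ξ * Φ s ξ * Φ l ξ ∂γ)
        = -(g / Δx) *
            ∑ p ∈ Finset.range (P + 1), ∑ s ∈ Finset.range (P + 1),
              ((b p + a p) / 2) * (zp s - zm s) *
                (∫ ξ, Φ p ξ * Φ s ξ * Φ l ξ ∂γ))
      (fun p => η p - zp p) (fun p => η p - zm p) := by
  have hT : ∀ p s, ∫ ξ, Φ p ξ * Φ s ξ * Φ l ξ ∂γ = ∫ ξ, Φ s ξ * Φ p ξ * Φ l ξ ∂γ :=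
    fun p s => by simp only [mul_comm (Φ p _)]
  beta_reduce
  rw [sum_mul_sub_mul_eq_sum_add_mul_sub _ (fun p => η p - zp p) (fun p => η p - zm p)
    (fun p s => ∫ ξ, Φ p ξ * Φ s ξ * Φ l ξ ∂γ) hT]
  simp only [Finset.mul_sum]
  refine Finset.sum_congr rfl fun p _ => Finset.sum_congr rfl fun s _ => ?_
  field_simp
  ring
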